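/- Let m ≥ 2 and let φ ∈ C¹((0,∞)) ∩ C⁰([0,∞)) satisfy φ(0) = 0, φ(t) > 0 for all t > 0, and φ(t) ≤ A t^δ for all t ≥ 0, for some positive constants A and δ. Let Q : (0,∞) → ℝ be positive, non-decreasing, with Q(t) = o(t^{1+δ}) as t → +∞ and liminf_{r→+∞} Q(r)·(log r)/r^{1+δ} < +∞. Let b : ℝ^m → ℝ be continuous with b(x) ≥ 1/Q(|x|) for |x| > 0, let Γ ∈ ℝ, and let f : ℝ → ℝ be continuous with f(t) > 0 for all t ≥ Γ. Let Ω ⊆ ℝ^m be an unbounded open set with non-empty boundary ∂Ω. Suppose u : closure(Ω) → ℝ is continuous and bounded, is C² on Ω, the vector field X : Ω → ℝ^m defined by X(x) = φ(|∇u(x)|)·∇u(x)/|∇u(x)| when ∇u(x) ≠ 0 and X(x) = 0 when ∇u(x) = 0 is of class C¹ on Ω, div X (x) ≥ b(x) f(u(x)) for all x ∈ Ω, and u(x) ≤ Γ for all x ∈ ∂Ω. Then u(x) ≤ Γ for all x ∈ Ω. -/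

import Mathlib

open Filter Asymptotics Classical

/-- The divergence of a vector field on Euclidean space. -/
noncomputable def euclideanDiv {m : ℕ}
    (X : EuclideanSpace ℝ (Fin m) → EuclideanSpace ℝ (Fin m))
    (x : EuclideanSpace ℝ (Fin m)) : ℝ :=
  ∑ i, fderiv ℝ (fun y => X y i) x (EuclideanSpace.single i 1)

theorem hasDerivAt_max_zero_pow {n : ℕ} (hn : 2 ≤ n) (t : ℝ) :
    HasDerivAt (fun t : ℝ => max t 0 ^ n) (n * max t 0 ^ (n - 1)) t := by
  rcases lt_trichotomy t 0 with ht | rfl | ht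
  · have h : (fun t : ℝ => max t 0 ^ n) =ᶠ[nhds t] fun _ => 0 := by
      filter_upwards [gt_mem_nhds ht] with s hs
      rw [max_eq_right hs.le, zero_pow (by omega)]
    rw [max_eq_right ht.le, zero_pow (by omega), mul_zero]
    exact (hasDerivAt_const t (0 : ℝ)).congr_of_eventuallyEq h
  · rw [max_self, zero_pow (by omega), mul_zero, hasDerivAt_iff_isLittleO]
    simp only [max_self, sub_zero, smul_zero, zero_pow (show n ≠ 0 by omega)]
    refine IsBigO.trans_isLittleO (g := fun t : ℝ => t ^ n) ?_ ?_
    · refine IsBigO.of_bound 1 (Eventually.of_forall fun s => ?_)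
      rw [one_mul, norm_pow, norm_pow]
      refine pow_le_pow_left₀ (norm_nonneg _) ?_ n
      rw [Real.norm_eq_abs, Real.norm_eq_abs, abs_of_nonneg (le_max_right _ _)]
      exact max_le (le_abs_self s) (abs_nonneg s)
    · simpa using (isLittleO_pow_pow (𝕜 := ℝ) (show 1 < n by omega))
  · have h : (fun t : ℝ => max t 0 ^ n) =ᶠ[nhds t] fun t => t ^ n := by
      filter_upwards [lt_mem_nhds ht] with s hs
      rw [max_eq_left hs.le]
    rw [max_eq_left ht.le]
    exact (hasDerivAt_pow n t).congr_of_eventuallyEq h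

theorem contDiff_max_zero_pow {n : ℕ} (hn : 2 ≤ n) :
    ContDiff ℝ 1 (fun t : ℝ => max t 0 ^ n) := by
  rw [contDiff_one_iff_deriv]
  refine ⟨fun t => (hasDerivAt_max_zero_pow hn t).differentiableAt, ?_⟩
  rw [funext fun t => (hasDerivAt_max_zero_pow hn t).deriv]
  fun_prop

theorem integrable_fderiv_coord {m : ℕ}
    {Z : EuclideanSpace ℝ (Fin m) → EuclideanSpace ℝ (Fin m)}
    (hZ : ContDiff ℝ 1 Z) (hZc : HasCompactSupport Z) (i : Fin m) (w : EuclideanSpace ℝ (Fin m)) :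
    MeasureTheory.Integrable fun x => fderiv ℝ (fun y => Z y i) x w :=
  (((contDiff_euclidean.1 hZ i).continuous_fderiv one_ne_zero).clm_apply
    continuous_const).integrable_of_hasCompactSupport
      ((hZc.comp_left (g := fun z : EuclideanSpace ℝ (Fin m) => z i) rfl).fderiv_apply (𝕜 := ℝ) w)

theorem integrable_euclideanDiv {m : ℕ}
    {Z : EuclideanSpace ℝ (Fin m) → EuclideanSpace ℝ (Fin m)}
    (hZ : ContDiff ℝ 1 Z) (hZc : HasCompactSupport Z) :
    MeasureTheory.Integrable (euclideanDiv Z) :=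
  MeasureTheory.integrable_finsetSum _ fun i _ => integrable_fderiv_coord hZ hZc i _

/-- The divergence theorem for compactly supported fields. -/
theorem integral_euclideanDiv_eq_zero {m : ℕ}
    {Z : EuclideanSpace ℝ (Fin m) → EuclideanSpace ℝ (Fin m)}
    (hZ : ContDiff ℝ 1 Z) (hZc : HasCompactSupport Z) :
    ∫ x, euclideanDiv Z x = 0 := by
  unfold euclideanDiv
  rw [MeasureTheory.integral_finsetSum _ fun i _ => integrable_fderiv_coord hZ hZc i _]
  refine Finset.sum_eq_zero fun i _ => ?_
  have hi : ContDiff ℝ 1 fun y => Z y i := contDiff_euclidean.1 hZ i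
  have hic : HasCompactSupport fun y => Z y i :=
    hZc.comp_left (g := fun z : EuclideanSpace ℝ (Fin m) => z i) rfl
  have := integral_mul_fderiv_eq_neg_fderiv_mul_of_integrable (𝕜 := ℝ)
    (μ := MeasureTheory.volume)
    (f := fun _ : EuclideanSpace ℝ (Fin m) => (1 : ℝ)) (g := fun y => Z y i)
    (v := EuclideanSpace.single i 1) (by simp)
    (by simpa using integrable_fderiv_coord hZ hZc i (EuclideanSpace.single i 1))
    (by simpa using hi.continuous.integrable_of_hasCompactSupport hic)
    (fun _ _ => differentiableAt_const _) (fun x _ => hi.differentiable one_ne_zero x)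
  simpa using this

theorem euclideanDiv_smul {m : ℕ} {g : EuclideanSpace ℝ (Fin m) → ℝ}
    {X : EuclideanSpace ℝ (Fin m) → EuclideanSpace ℝ (Fin m)} {x : EuclideanSpace ℝ (Fin m)}
    (hg : DifferentiableAt ℝ g x) (hX : DifferentiableAt ℝ X x) :
    euclideanDiv (fun y => g y • X y) x = g x * euclideanDiv X x + fderiv ℝ g x (X x) := by
  have hi := differentiableAt_euclidean.1 hX
  have hx : X x = ∑ i, X x i • EuclideanSpace.single i (1 : ℝ) := by
    ext j
    simp [Pi.single_apply]
  conv_rhs => rw [hx, map_sum]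
  unfold euclideanDiv
  rw [Finset.mul_sum, ← Finset.sum_add_distrib]
  refine Finset.sum_congr rfl fun i _ => ?_
  have : (fun y => (g y • X y) i) = fun y => g y * X y i := by ext; simp
  rw [this, fderiv_fun_mul hg (hi i)]
  simp

theorem euclideanDiv_congr {m : ℕ}
    {X Y : EuclideanSpace ℝ (Fin m) → EuclideanSpace ℝ (Fin m)} {x : EuclideanSpace ℝ (Fin m)}
    (h : X =ᶠ[nhds x] Y) : euclideanDiv X x = euclideanDiv Y x := by
  unfold euclideanDiv
  refine Finset.sum_congr rfl fun i _ => ?_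
  have hi : (fun y => X y i) =ᶠ[nhds x] fun y => Y y i :=
    h.fun_comp fun z : EuclideanSpace ℝ (Fin m) => z i
  rw [hi.fderiv_eq]

section Truncation

variable {m : ℕ} {Ω : Set (EuclideanSpace ℝ (Fin m))} {v : EuclideanSpace ℝ (Fin m) → ℝ}
  {X : EuclideanSpace ℝ (Fin m) → EuclideanSpace ℝ (Fin m)} {n : ℕ}

theorem indicator_max_pow_smul_eventuallyEq_zero (hn : n ≠ 0) {x : EuclideanSpace ℝ (Fin m)}
    (hx : ∀ᶠ y in nhds x, y ∈ Ω → v y ≤ 0) :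
    Ω.indicator (fun y => max (v y) 0 ^ n • X y) =ᶠ[nhds x] 0 := by
  filter_upwards [hx] with y hy
  by_cases hyΩ : y ∈ Ω
  · rw [Set.indicator_of_mem hyΩ, max_eq_right (hy hyΩ), zero_pow hn, zero_smul]
    rfl
  · rw [Set.indicator_of_notMem hyΩ]
    rfl

theorem indicator_eventuallyEq_self (hΩ : IsOpen Ω) {x : EuclideanSpace ℝ (Fin m)} (hx : x ∈ Ω) :
    Ω.indicator (fun y => max (v y) 0 ^ n • X y) =ᶠ[nhds x] fun y => max (v y) 0 ^ n • X y := by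
  filter_upwards [hΩ.mem_nhds hx] with y hy
  exact Set.indicator_of_mem hy _

theorem contDiff_indicator_max_pow_smul (hn : 2 ≤ n) (hΩ : IsOpen Ω) (hv : ContDiffOn ℝ 1 v Ω)
    (hX : ContDiffOn ℝ 1 X Ω) (hneg : ∀ x ∉ Ω, ∀ᶠ y in nhds x, y ∈ Ω → v y ≤ 0) :
    ContDiff ℝ 1 (Ω.indicator fun y => max (v y) 0 ^ n • X y) := by
  rw [contDiff_iff_contDiffAt]
  intro x
  by_cases hx : x ∈ Ω
  · refine ContDiffAt.congr_of_eventuallyEq ?_ (indicator_eventuallyEq_self hΩ hx)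
    have hvx := hv.contDiffAt (hΩ.mem_nhds hx)
    exact ((contDiff_max_zero_pow hn).contDiffAt.comp x hvx).smul (hX.contDiffAt (hΩ.mem_nhds hx))
  · exact contDiffAt_const.congr_of_eventuallyEq
      (indicator_max_pow_smul_eventuallyEq_zero (by omega) (hneg x hx))

theorem euclideanDiv_indicator_max_pow_smul (hn : 2 ≤ n) (hΩ : IsOpen Ω)
    (hv : ContDiffOn ℝ 1 v Ω) (hX : ContDiffOn ℝ 1 X Ω) {x : EuclideanSpace ℝ (Fin m)}
    (hx : x ∈ Ω) :
    euclideanDiv (Ω.indicator fun y => max (v y) 0 ^ n • X y) x =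
      max (v x) 0 ^ n * euclideanDiv X x +
        n * max (v x) 0 ^ (n - 1) * fderiv ℝ v x (X x) := by
  have hvx := (hv.contDiffAt (hΩ.mem_nhds hx)).differentiableAt one_ne_zero
  have hXx := (hX.contDiffAt (hΩ.mem_nhds hx)).differentiableAt one_ne_zero
  have h := (hasDerivAt_max_zero_pow hn (v x)).comp_hasFDerivAt x hvx.hasFDerivAt
  rw [euclideanDiv_congr (indicator_eventuallyEq_self hΩ hx)]
  change euclideanDiv (fun y => ((fun t : ℝ => max t 0 ^ n) ∘ v) y • X y) x = _
  rw [euclideanDiv_smul h.differentiableAt hXx, h.fderiv]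
  simp

/-- If `div X ≥ a` and the flux `⟨∇v, X⟩` is at least `-K` where `v > 0`, then testing with the
field `v₊ⁿ X` bounds the size of the superlevel sets of `v`. -/
theorem pow_mul_volume_ball_le (hn : 2 ≤ n) (hΩ : IsOpen Ω) (hv : ContDiffOn ℝ 1 v Ω)
    (hX : ContDiffOn ℝ 1 X Ω) (hneg : ∀ x ∉ Ω, ∀ᶠ y in nhds x, y ∈ Ω → v y ≤ 0)
    {R : ℝ} (hR : ∀ x ∈ Ω, R ≤ ‖x‖ → v x ≤ 0) {a K τ σ : ℝ} (ha : 0 < a) (hK : 0 ≤ K)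
    (hdiv : ∀ᵐ x, x ∈ Ω → 0 < v x → a ≤ euclideanDiv X x)
    (hflux : ∀ x ∈ Ω, 0 < v x → -K ≤ fderiv ℝ v x (X x))
    (hτ : 2 * (n * K) = a * τ) (hτσ : τ ≤ σ) {x₁ : EuclideanSpace ℝ (Fin m)} {ρ : ℝ}
    (hball : ∀ x ∈ Metric.ball x₁ ρ, x ∈ Ω ∧ σ ≤ v x) :
    σ ^ n * MeasureTheory.volume.real (Metric.ball x₁ ρ) ≤
      τ ^ n * MeasureTheory.volume.real (Metric.ball (0 : EuclideanSpace ℝ (Fin m)) R) := by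
  have hn0 : n ≠ 0 := by omega
  have hn1 : n - 1 ≠ 0 := by omega
  have hτ0 : 0 ≤ τ := by
    have : 0 ≤ a * τ := hτ ▸ by positivity
    exact nonneg_of_mul_nonneg_right this ha
  set Z := Ω.indicator fun y => max (v y) 0 ^ n • X y with hZ
  have hZ1 : ContDiff ℝ 1 Z := contDiff_indicator_max_pow_smul hn hΩ hv hX hneg
  have hZc : HasCompactSupport Z := by
    refine HasCompactSupport.intro (isCompact_closedBall 0 R) fun x hx => ?_
    rw [mem_closedBall_zero_iff, not_le] at hx
    by_cases hxΩ : x ∈ Ω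
    · rw [hZ, Set.indicator_of_mem hxΩ, max_eq_right (hR x hxΩ hx.le), zero_pow hn0, zero_smul]
    · exact Set.indicator_of_notMem hxΩ _
  have hint : ∀ (c : ℝ) (y : EuclideanSpace ℝ (Fin m)) (r : ℝ), MeasureTheory.Integrable
      ((Metric.ball y r).indicator fun _ => c) := fun c y r =>
    (MeasureTheory.integrable_indicator_iff Metric.isOpen_ball.measurableSet).2
      (MeasureTheory.integrableOn_const MeasureTheory.measure_ball_lt_top.ne)
  have hle : ∀ᵐ x, (Metric.ball x₁ ρ).indicator (fun _ => a / 2 * σ ^ n) x -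
      (Metric.ball 0 R).indicator (fun _ => a / 2 * τ ^ n) x ≤ euclideanDiv Z x := by
    filter_upwards [hdiv] with x hx
    have hind : 0 ≤ (Metric.ball 0 R).indicator (fun _ => a / 2 * τ ^ n) x :=
      Set.indicator_nonneg (fun _ _ => by positivity) x
    by_cases hxΩ : x ∈ Ω
    swap
    · have h0 : euclideanDiv Z x = 0 := by
        rw [euclideanDiv_congr (indicator_max_pow_smul_eventuallyEq_zero hn0 (hneg x hxΩ))]
        simp [euclideanDiv]
      rw [h0, Set.indicator_of_notMem fun h => hxΩ (hball x h).1]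
      linarith
    rw [hZ, euclideanDiv_indicator_max_pow_smul hn hΩ hv hX hxΩ]
    rcases le_or_gt (v x) 0 with hv0 | hv0
    · rw [max_eq_right hv0, zero_pow hn0, zero_pow hn1]
      by_cases hxb : x ∈ Metric.ball x₁ ρ
      · have h1 : σ = 0 := by linarith [(hball x hxb).2]
        rw [Set.indicator_of_mem hxb, h1, zero_pow hn0]
        linarith
      · rw [Set.indicator_of_notMem hxb]
        linarith
    · have hxR : x ∈ Metric.ball (0 : EuclideanSpace ℝ (Fin m)) R := by
        rw [mem_ball_zero_iff]
        by_contra! h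
        exact absurd (hR x hxΩ h) hv0.not_ge
      rw [max_eq_left hv0.le, Set.indicator_of_mem hxR]
      have hp : v x ^ n = v x ^ (n - 1) * v x := by
        rw [← pow_succ, Nat.sub_add_cancel (by omega)]
      have hp' : τ ^ n = τ ^ (n - 1) * τ := by
        rw [← pow_succ, Nat.sub_add_cancel (by omega)]
      have hpos : 0 < v x ^ (n - 1) := pow_pos hv0 _
      have hlow : v x ^ n * a - v x ^ (n - 1) * (a * τ / 2) ≤ v x ^ n * euclideanDiv X x +
          n * v x ^ (n - 1) * fderiv ℝ v x (X x) := by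
        have h1 := mul_le_mul_of_nonneg_left (hx hxΩ hv0) (pow_pos hv0 n).le
        have h2 := mul_le_mul_of_nonneg_left (hflux x hxΩ hv0)
          (show 0 ≤ n * v x ^ (n - 1) by positivity)
        have h3 : v x ^ (n - 1) * (a * τ / 2) = n * v x ^ (n - 1) * K := by
          rw [← hτ]; ring
        linarith
      refine le_trans ?_ hlow
      have hσ : (Metric.ball x₁ ρ).indicator (fun _ => a / 2 * σ ^ n) x ≤
          if τ ≤ v x then a / 2 * v x ^ n else 0 := by
        by_cases hxb : x ∈ Metric.ball x₁ ρ
        · have := (hball x hxb).2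
          rw [Set.indicator_of_mem hxb, if_pos (hτσ.trans this)]
          have := pow_le_pow_left₀ (hτ0.trans hτσ) this n
          gcongr
        · rw [Set.indicator_of_notMem hxb]
          split_ifs <;> positivity
      have hτn : 0 ≤ τ ^ n := pow_nonneg hτ0 n
      split_ifs at hσ with h
      · have : v x ^ (n - 1) * τ ≤ v x ^ n := by
          rw [hp]; gcongr
        nlinarith
      · have h1 : v x ^ (n - 1) * τ ≤ τ ^ n := by
          rw [hp']
          have := pow_le_pow_left₀ hv0.le (not_le.1 h).le (n - 1)
          gcongr
        have h2 : 0 ≤ v x ^ n := by positivity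
        nlinarith
  have := MeasureTheory.integral_mono_ae ((hint _ _ _).sub (hint _ _ _))
    (integrable_euclideanDiv hZ1 hZc) hle
  rw [integral_euclideanDiv_eq_zero hZ1 hZc] at this
  simp only [Pi.sub_apply] at this
  rw [MeasureTheory.integral_sub (hint _ _ _) (hint _ _ _),
    MeasureTheory.integral_indicator_const _ Metric.isOpen_ball.measurableSet,
    MeasureTheory.integral_indicator_const _ Metric.isOpen_ball.measurableSet] at this
  simp only [smul_eq_mul] at this
  nlinarith

end Truncation

theorem inner_sub_ge_of_le_rpow {E : Type*} [NormedAddCommGroup E] [InnerProductSpace ℝ E]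
    {φ : ℝ → ℝ} {A δ : ℝ} (hA : 0 < A) (hδ : 0 < δ) (hφ0 : φ 0 = 0)
    (hφpos : ∀ t > (0 : ℝ), 0 < φ t) (hφA : ∀ t ≥ (0 : ℝ), φ t ≤ A * t ^ δ) {p q Y : E}
    (hY0 : p = 0 → Y = 0) (hY : p ≠ 0 → Y = (φ ‖p‖ / ‖p‖) • p) {s : ℝ} (hs : ‖q‖ ≤ s) :
    -(A * s ^ (1 + δ)) ≤ inner ℝ p Y - inner ℝ q Y := by
  have hs0 : 0 ≤ s := (norm_nonneg q).trans hs
  have hφnn : 0 ≤ φ ‖p‖ := by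
    rcases (norm_nonneg p).eq_or_lt with h | h
    · rw [← h, hφ0]
    · exact (hφpos _ h).le
  have h1 : inner ℝ p Y = φ ‖p‖ * ‖p‖ ∧ ‖Y‖ = φ ‖p‖ := by
    by_cases hp : p = 0
    · simp [hY0 hp, hp, hφ0]
    · have hp' : ‖p‖ ≠ 0 := norm_ne_zero_iff.2 hp
      rw [hY hp, inner_smul_right, real_inner_self_eq_norm_sq, norm_smul, norm_div, norm_norm,
        Real.norm_of_nonneg hφnn]
      constructor <;> field_simp
  have h2 : inner ℝ q Y ≤ φ ‖p‖ * s := by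
    refine (real_inner_le_norm q Y).trans ?_
    rw [h1.2, mul_comm]
    gcongr
  rw [h1.1]
  rcases le_total s ‖p‖ with h | h
  · have : φ ‖p‖ * s ≤ φ ‖p‖ * ‖p‖ := by gcongr
    have : 0 ≤ A * s ^ (1 + δ) := by positivity
    linarith
  · have h3 : φ ‖p‖ ≤ A * s ^ δ := (hφA _ (norm_nonneg p)).trans (by gcongr)
    have h4 : φ ‖p‖ * s ≤ A * s ^ δ * s := by gcongr
    have h5 : s ^ (1 + δ) = s ^ δ * s := by
      rw [Real.rpow_add' hs0 (by positivity), Real.rpow_one, mul_comm]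
    have h6 : 0 ≤ φ ‖p‖ * ‖p‖ := by positivity
    rw [h5]
    linarith

theorem fderiv_sub_mul_norm_sq_apply {E : Type*} [NormedAddCommGroup E] [InnerProductSpace ℝ E]
    [CompleteSpace E] {u : E → ℝ} {x : E} (hu : DifferentiableAt ℝ u x) (γ κ : ℝ) (w : E) :
    fderiv ℝ (fun y => u y - γ - κ * ‖y‖ ^ 2) x w =
      inner ℝ (gradient u x) w - inner ℝ ((2 * κ) • x) w := by
  have h := (hu.hasFDerivAt.sub_const γ).sub
    ((hasStrictFDerivAt_norm_sq x).hasFDerivAt.const_mul κ)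
  rw [inner_gradient_left, inner_smul_left]
  change fderiv ℝ ((fun y => u y - γ) - fun y => κ * ‖y‖ ^ 2) x w = _
  rw [h.fderiv]
  simp
  ring

theorem stmt15 {m : ℕ} (hm : 2 ≤ m)
    (φ : ℝ → ℝ) (A δ : ℝ) (hA : 0 < A) (hδ : 0 < δ)
    (hφC0 : ContinuousOn φ (Set.Ici 0)) (hφC1 : ContDiffOn ℝ 1 φ (Set.Ioi 0))
    (hφ0 : φ 0 = 0) (hφpos : ∀ t > (0:ℝ), 0 < φ t)
    (hφA : ∀ t ≥ (0:ℝ), φ t ≤ A * t ^ δ)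
    (Q : ℝ → ℝ)
    (hQpos : ∀ t > (0:ℝ), 0 < Q t)
    (hQmono : ∀ s t : ℝ, 0 < s → s ≤ t → Q s ≤ Q t)
    (hQo : Q =o[atTop] fun t => t ^ (1 + δ))
    (hliminf : ∃ C : ℝ, ∃ᶠ r in atTop, Q r * Real.log r / r ^ (1 + δ) ≤ C)
    (b : EuclideanSpace ℝ (Fin m) → ℝ) (hb : Continuous b)
    (hbQ : ∀ x : EuclideanSpace ℝ (Fin m), 0 < ‖x‖ → 1 / Q ‖x‖ ≤ b x)
    (Γ : ℝ) (f : ℝ → ℝ) (hf : Continuous f) (hfpos : ∀ t ≥ Γ, 0 < f t)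
    (Ω : Set (EuclideanSpace ℝ (Fin m))) (hΩopen : IsOpen Ω)
    (hΩunbounded : ¬ Bornology.IsBounded Ω)
    (hΩbdry : (frontier Ω).Nonempty)
    (u : EuclideanSpace ℝ (Fin m) → ℝ)
    (hucont : ContinuousOn u (closure Ω))
    (hubdd : ∃ C : ℝ, ∀ x ∈ closure Ω, |u x| ≤ C)
    (huC2 : ContDiffOn ℝ 2 u Ω)
    (X : EuclideanSpace ℝ (Fin m) → EuclideanSpace ℝ (Fin m))
    (hXdef : ∀ x ∈ Ω, X x = if gradient u x = 0 then 0 else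
      (φ ‖gradient u x‖ / ‖gradient u x‖) • gradient u x)
    (hXC1 : ContDiffOn ℝ 1 X Ω)
    (hineq : ∀ x ∈ Ω, b x * f (u x) ≤ euclideanDiv X x)
    (hbc : ∀ x ∈ frontier Ω, u x ≤ Γ) :
    ∀ x ∈ Ω, u x ≤ Γ := by
  have : Nonempty (Fin m) := ⟨⟨0, by omega⟩⟩
  have : Nontrivial (EuclideanSpace ℝ (Fin m)) := inferInstance
  by_contra! hcon
  obtain ⟨x₀, hx₀, hux₀⟩ := hcon
  obtain ⟨C₀, hC₀⟩ := hubdd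
  -- the supremum `M > Γ` of `u`, and a positive lower bound `c` for `f` on `[Γ, M]`
  have hbdd : BddAbove (u '' Ω) := ⟨C₀, by
    rintro _ ⟨x, hx, rfl⟩
    exact (le_abs_self _).trans (hC₀ x (subset_closure hx))⟩
  set M := sSup (u '' Ω) with hM
  have huM : ∀ x ∈ Ω, u x ≤ M := fun x hx => le_csSup hbdd ⟨x, hx, rfl⟩
  have hΓM : Γ < M := hux₀.trans_le (huM x₀ hx₀)
  obtain ⟨t₀, ht₀, hmin⟩ := (isCompact_Icc (a := Γ) (b := M)).exists_isMinOn
    ⟨Γ, le_rfl, hΓM.le⟩ hf.continuousOn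
  set c := f t₀ with hc
  have hc0 : 0 < c := hfpos t₀ ht₀.1
  have hfc : ∀ x ∈ Ω, Γ ≤ u x → c ≤ f (u x) := fun x hx h => hmin ⟨h, huM x hx⟩
  obtain ⟨C, hC⟩ := hliminf
  set C' := max C 1
  have hC' : 0 < C' := lt_of_lt_of_le one_pos (le_max_right _ _)
  set κ := 2 * ((m + 2) * A * 2 ^ (1 + δ) * C') / c with hκ
  have hκ0 : 0 < κ := by positivity
  -- a small oscillation `ω`
  obtain ⟨ω, hω0, hωM, hωκ⟩ : ∃ ω : ℝ, 0 < ω ∧ ω < M - Γ ∧ κ * ω ^ δ < 1 / 6 := by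
    have h1 : Tendsto (fun ω : ℝ => κ * ω ^ δ) (nhds 0) (nhds (κ * 0 ^ δ)) :=
      ((Real.continuousAt_rpow_const 0 δ (Or.inr hδ.le)).tendsto).const_mul κ
    rw [Real.zero_rpow hδ.ne', mul_zero] at h1
    have h2 := (h1.eventually (gt_mem_nhds (show (0 : ℝ) < 1 / 6 by norm_num))).and
      (gt_mem_nhds (show (0 : ℝ) < M - Γ by linarith))
    obtain ⟨ω, hω, h3⟩ := ((h2.filter_mono nhdsWithin_le_nhds).and
      (self_mem_nhdsWithin (s := Set.Ioi (0 : ℝ)))).exists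
    exact ⟨ω, h3, hω.2, hω.1⟩
  set γ := M - ω with hγ
  have hγΓ : Γ < γ := by linarith
  obtain ⟨_, ⟨x₁, hx₁, rfl⟩, hux₁⟩ := exists_lt_of_lt_csSup (s := u '' Ω) ⟨_, x₀, hx₀, rfl⟩
    (show M - ω / 4 < sSup (u '' Ω) by linarith)
  have huΩ : ContinuousOn u Ω := hucont.mono subset_closure
  obtain ⟨ρ', hρ'0, hρ'⟩ := Metric.mem_nhds_iff.1 (((huΩ.continuousAt (hΩopen.mem_nhds hx₁)).eventually
    (lt_mem_nhds hux₁)).and (hΩopen.mem_nhds hx₁))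
  set ρ := min ρ' 1
  have hρ0 : 0 < ρ := lt_min hρ'0 one_pos
  have hρ : ∀ x ∈ Metric.ball x₁ ρ, x ∈ Ω ∧ M - ω / 4 < u x ∧ ‖x‖ < ‖x₁‖ + 1 := fun x hx => by
    have h1 := hρ' (Metric.ball_subset_ball (min_le_left _ _) hx)
    refine ⟨h1.2, h1.1, ?_⟩
    have h2 : ‖x - x₁‖ < 1 := (mem_ball_iff_norm.1 hx).trans_le (min_le_right _ _)
    linarith [norm_le_norm_add_norm_sub' x x₁]
  set V₁ := MeasureTheory.volume.real (Metric.ball x₁ ρ) with hV₁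
  set V := MeasureTheory.volume.real (Metric.ball (0 : EuclideanSpace ℝ (Fin m)) 1) with hV
  have hV₁0 : 0 < V₁ := ENNReal.toReal_pos (Metric.measure_ball_pos _ _ hρ0).ne'
    MeasureTheory.measure_ball_lt_top.ne
  -- a large radius `R` along which the growth hypothesis holds
  obtain ⟨R, hCR, hR⟩ := (hC.and_eventually ((eventually_gt_atTop (V / V₁)).and
    ((eventually_ge_atTop (2 * (‖x₁‖ + 1))).and (eventually_ge_atTop (Real.exp 1))))).exists
  obtain ⟨hRV, hRx, hRe⟩ := hR
  have hR0 : 0 < R := (Real.exp_pos 1).trans_le hRe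
  have hlog : 1 ≤ Real.log R := (Real.le_log_iff_exp_le hR0).2 hRe
  have hQR := hQpos R hR0
  set n := ⌈(m + 1) * Real.log R⌉₊ with hn_def
  have hm2 : (2 : ℝ) ≤ m := by exact_mod_cast hm
  have hnl : (m + 1) * Real.log R ≤ n := Nat.le_ceil _
  have hnu : (n : ℝ) ≤ (m + 2) * Real.log R := by
    have := Nat.ceil_lt_add_one (show 0 ≤ (m + 1) * Real.log R by positivity)
    linarith
  have hn : 2 ≤ n := by
    have : (2 : ℝ) ≤ n := by nlinarith
    exact_mod_cast this
  set s := 2 * ω / R with hs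
  set K := A * s ^ (1 + δ) with hK
  have hK0 : 0 ≤ K := by positivity
  set a := c / Q R with ha
  have ha0 : 0 < a := by positivity
  set τ := 2 * (n * K) / a with hτ
  have hτ0 : 0 ≤ τ := by positivity
  have hτω : τ ≤ ω / 6 := by
    have h1 : Q R * Real.log R ≤ C' * R ^ (1 + δ) :=
      (div_le_iff₀ (by positivity)).1 (hCR.trans (le_max_left _ _))
    have h2 : s ^ (1 + δ) = 2 ^ (1 + δ) * (ω * ω ^ δ) / R ^ (1 + δ) := by
      rw [hs, Real.div_rpow (by positivity) hR0.le, Real.mul_rpow (by norm_num) hω0.le,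
        Real.rpow_add hω0, Real.rpow_one]
    have h3 : τ = n * Q R * (2 * A * 2 ^ (1 + δ) * (ω * ω ^ δ) / (c * R ^ (1 + δ))) := by
      rw [hτ, hK, ha, h2]
      field_simp
    have h4 : n * Q R ≤ (m + 2) * (C' * R ^ (1 + δ)) := by
      calc n * Q R ≤ (m + 2) * Real.log R * Q R := by gcongr
        _ = (m + 2) * (Q R * Real.log R) := by ring
        _ ≤ _ := by gcongr
    calc τ ≤ (m + 2) * (C' * R ^ (1 + δ)) *
          (2 * A * 2 ^ (1 + δ) * (ω * ω ^ δ) / (c * R ^ (1 + δ))) := by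
          rw [h3]; gcongr
      _ = ω * (κ * ω ^ δ) := by
          rw [hκ]
          have : R ^ (1 + δ) ≠ 0 := by positivity
          field_simp
      _ ≤ ω * (1 / 6) := by gcongr
      _ = ω / 6 := by ring
  set v : EuclideanSpace ℝ (Fin m) → ℝ := fun y => u y - γ - ω / R ^ 2 * ‖y‖ ^ 2 with hv
  have hvu : ∀ x, v x ≤ u x - γ := fun x => by
    have : 0 ≤ ω / R ^ 2 * ‖x‖ ^ 2 := by positivity
    simp only [hv]
    linarith
  have hvR : ∀ x ∈ Ω, R ≤ ‖x‖ → v x ≤ 0 := fun x hx h => by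
    have h1 : ω / R ^ 2 * R ^ 2 ≤ ω / R ^ 2 * ‖x‖ ^ 2 := by gcongr
    rw [div_mul_cancel₀ _ (by positivity)] at h1
    have := huM x hx
    simp only [hv]
    linarith
  have hneg : ∀ x ∉ Ω, ∀ᶠ y in nhds x, y ∈ Ω → v y ≤ 0 := fun x hx => by
    by_cases hxc : x ∈ closure Ω
    · have hxf : x ∈ frontier Ω := ⟨hxc, by rwa [hΩopen.interior_eq]⟩
      have h1 := (hucont x hxc).eventually (gt_mem_nhds ((hbc x hxf).trans_lt hγΓ))
      filter_upwards [eventually_nhdsWithin_iff.1 h1] with y hy hyΩ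
      linarith [hvu y, hy (subset_closure hyΩ)]
    · filter_upwards [isClosed_closure.isOpen_compl.mem_nhds hxc] with y hy hyΩ
      exact absurd (subset_closure hyΩ) hy
  have hvC1 : ContDiffOn ℝ 1 v Ω :=
    ((huC2.of_le one_le_two).sub contDiffOn_const).sub
      (contDiff_const.mul (contDiff_norm_sq ℝ)).contDiffOn
  have hdiv : ∀ᵐ x, x ∈ Ω → 0 < v x → a ≤ euclideanDiv X x := by
    have h0 : ∀ᵐ x : EuclideanSpace ℝ (Fin m), x ≠ 0 :=
      MeasureTheory.Measure.ae_ne MeasureTheory.volume 0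
    filter_upwards [h0] with x hx0 hx hvx
    have hxpos := norm_pos_iff.2 hx0
    have hxR : ‖x‖ ≤ R := by
      by_contra! h
      exact absurd (hvR x hx h.le) hvx.not_ge
    have h1 : 1 / Q R ≤ b x :=
      (one_div_le_one_div_of_le (hQpos _ hxpos) (hQmono _ _ hxpos hxR)).trans (hbQ x hxpos)
    have h2 := hfc x hx (by linarith [hvu x])
    calc a = 1 / Q R * c := by rw [ha]; ring
      _ ≤ b x * f (u x) := mul_le_mul h1 h2 hc0.le ((one_div_pos.2 hQR).le.trans h1)
      _ ≤ _ := hineq x hx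
  have hflux : ∀ x ∈ Ω, 0 < v x → -K ≤ fderiv ℝ v x (X x) := fun x hx hvx => by
    have hxR : ‖x‖ ≤ R := by
      by_contra! h
      exact absurd (hvR x hx h.le) hvx.not_ge
    rw [hv, fderiv_sub_mul_norm_sq_apply
      ((huC2.contDiffAt (hΩopen.mem_nhds hx)).differentiableAt two_ne_zero)]
    refine inner_sub_ge_of_le_rpow hA hδ hφ0 hφpos hφA (fun h => ?_) (fun h => ?_) ?_
    · rw [hXdef x hx, if_pos h]
    · rw [hXdef x hx, if_neg h]
    · rw [norm_smul, Real.norm_of_nonneg (by positivity)]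
      calc 2 * (ω / R ^ 2) * ‖x‖ ≤ 2 * (ω / R ^ 2) * R := by gcongr
        _ = s := by rw [hs]; field_simp
  have hball : ∀ x ∈ Metric.ball x₁ ρ, x ∈ Ω ∧ ω / 2 ≤ v x := fun x hx => by
    obtain ⟨h1, h2, h3⟩ := hρ x hx
    refine ⟨h1, ?_⟩
    have h4 : ω / R ^ 2 * ‖x‖ ^ 2 ≤ ω / R ^ 2 * (R / 2) ^ 2 := by
      have : ‖x‖ ≤ R / 2 := by linarith
      gcongr
    have h5 : ω / R ^ 2 * (R / 2) ^ 2 = ω / 4 := by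
      field_simp
      norm_num
    simp only [hv]
    linarith
  have key := pow_mul_volume_ball_le (τ := τ) hn hΩopen hvC1 hXC1 hneg hvR ha0 hK0 hdiv hflux
    (by rw [hτ]; field_simp) (by linarith) hball
  have hvol : MeasureTheory.volume.real (Metric.ball (0 : EuclideanSpace ℝ (Fin m)) R) =
      R ^ m * V := by
    rw [MeasureTheory.measureReal_def, MeasureTheory.Measure.addHaar_ball _ _ hR0.le,
      ENNReal.toReal_mul, ENNReal.toReal_ofReal (by positivity)]
    simp [hV, MeasureTheory.measureReal_def]
  rw [hvol, ← hV₁] at key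
  have hexp : R ^ (m + 1) ≤ 3 ^ n := by
    have h1 : R ^ (m + 1) = Real.exp ((m + 1) * Real.log R) := by
      rw [← Real.exp_log hR0, ← Real.exp_nat_mul, Real.log_exp]
      push_cast
      rfl
    rw [h1]
    calc _ ≤ Real.exp n := Real.exp_le_exp.2 hnl
      _ = Real.exp 1 ^ n := by rw [← Real.exp_nat_mul, mul_one]
      _ ≤ 3 ^ n := by
        gcongr
        linarith [Real.exp_one_lt_d9]
  have hτn : τ ^ n ≤ (ω / 6) ^ n := pow_le_pow_left₀ hτ0 hτω n
  have hV0 : 0 ≤ V := MeasureTheory.measureReal_nonneg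
  have h1 : (ω / 6) ^ n * (3 ^ n * V₁) ≤ (ω / 6) ^ n * (R ^ m * V) := by
    have h2 : (ω / 2) ^ n = (ω / 6) ^ n * 3 ^ n := by rw [← mul_pow]; ring
    calc _ = (ω / 2) ^ n * V₁ := by rw [h2]; ring
      _ ≤ τ ^ n * (R ^ m * V) := key
      _ ≤ _ := by gcongr
  have h2 : 3 ^ n * V₁ ≤ R ^ m * V := le_of_mul_le_mul_left h1 (by positivity)
  have h3 : R ^ m * (R * V₁) ≤ R ^ m * V := by
    calc _ = R ^ (m + 1) * V₁ := by ring
      _ ≤ 3 ^ n * V₁ := by gcongr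
      _ ≤ _ := h2
  have h4 := le_of_mul_le_mul_left h3 (by positivity)
  exact absurd ((div_lt_iff₀ hV₁0).1 hRV) h4.not_gt
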